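/- Let H be a Hopf algebra with a ℤⁿ×ℤⁿ-grading satisfying conditions (i)–(iv), and let A be a right H-comodule algebra with a ℤⁿ×ℤⁿ-grading such that the product of A adds degrees and the coaction satisfies δ(A_{(r,l)}) ⊆ ⊕_{s∈ℤⁿ} A_{(r,s)}⊗H_{(s,l)}. Then A_Θ = (A, ·_Θ) is a right H_Θ-comodule algebra with the same coaction, i.e., δ(a ·_Θ ã) = (a₍₀₎ ·_Θ ã₍₀₎) ⊗ (a₍₁₎ ·_Θ ã₍₁₎) for all a, ã ∈ A; moreover the coinvariant subspace B = A^{coH} is unchanged and is closed under ·_Θ, so B_Θ = (B, ·_Θ) is a subalgebra of A_Θ. -/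

import Mathlib

/- Statement 9 (Scenario II): For H a bigraded Hopf algebra (conditions (i)-(iv)) and A
a compatibly bigraded right H-comodule algebra, A_Θ = (A, ·_Θ) is a right H_Θ-comodule
algebra with the same coaction, and the coinvariant subspace B = A^{coH} is unchanged
and closed under ·_Θ. -/

open TensorProduct DirectSum

noncomputable section

/-- The phase factor `λ_θ(r,l) = exp(πi⟨θr,l⟩)`. -/
def phase {n : ℕ} (θ : Matrix (Fin n) (Fin n) ℝ) (r l : Fin n → ℤ) : ℂ :=
  Complex.exp ((Real.pi : ℂ) * Complex.I * ∑ j, ∑ k, (θ j k : ℂ) * (r k : ℂ) * (l j : ℂ))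

/-- The phase factor for the matrix `Θ = diag(θ, -θ)` on the bigrading:
`λ_Θ((r₁,r₂),(l₁,l₂)) = λ_θ(r₁,l₁)·λ_{-θ}(r₂,l₂)`. -/
def phaseTheta {n : ℕ} (θ : Matrix (Fin n) (Fin n) ℝ)
    (r l : (Fin n → ℤ) × (Fin n → ℤ)) : ℂ :=
  phase θ r.1 l.1 * phase (-θ) r.2 l.2

/-- The deformation of the product of a graded algebra by a "bi-character" `c`:
the bilinear extension of `a_r ⊗ ã_l ↦ c r l • (a_r * ã_l)` on homogeneous elements. -/
def defMul {ι : Type} [DecidableEq ι] {A : Type} [Ring A] [Algebra ℂ A]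
    (𝒜 : ι → Submodule ℂ A) [DirectSum.Decomposition 𝒜] (c : ι → ι → ℂ) :
    A →ₗ[ℂ] A →ₗ[ℂ] A :=
  let bil : (⨁ r, ↥(𝒜 r)) →ₗ[ℂ] (⨁ l, ↥(𝒜 l)) →ₗ[ℂ] A :=
    DirectSum.toModule ℂ ι _ (fun r =>
      (DirectSum.toModule ℂ ι (↥(𝒜 r) →ₗ[ℂ] A) (fun l =>
        (c r l • ((LinearMap.mul ℂ A).compl₁₂ (𝒜 r).subtype (𝒜 l).subtype)).flip)).flip)
  let dec : A →ₗ[ℂ] ⨁ r, ↥(𝒜 r) := (DirectSum.decomposeLinearEquiv 𝒜).toLinearMap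
  (bil ∘ₗ dec).compl₂ dec

/-- On homogeneous elements the deformed product is the original one, scaled by the phase. -/
theorem defMul_of_mem {ι : Type} [DecidableEq ι] {A : Type} [Ring A] [Algebra ℂ A]
    (𝒜 : ι → Submodule ℂ A) [DirectSum.Decomposition 𝒜] (c : ι → ι → ℂ) {r l : ι} {a b : A}
    (ha : a ∈ 𝒜 r) (hb : b ∈ 𝒜 l) : defMul 𝒜 c a b = c r l • (a * b) := by
  lift a to 𝒜 r using ha
  lift b to 𝒜 l using hb
  simp only [defMul, LinearMap.compl₂_apply, LinearMap.comp_apply, LinearEquiv.coe_coe,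
    DirectSum.decomposeLinearEquiv_apply, DirectSum.decompose_coe]
  rw [← DirectSum.lof_eq_of ℂ, ← DirectSum.lof_eq_of ℂ, DirectSum.toModule_lof,
    LinearMap.flip_apply, DirectSum.toModule_lof]
  simp

theorem phase_mul_phase_neg {n : ℕ} (θ : Matrix (Fin n) (Fin n) ℝ) (r l : Fin n → ℤ) :
    phase (-θ) r l * phase θ r l = 1 := by
  simp [phase, ← Complex.exp_add]

theorem phaseTheta_mul_phaseTheta {n : ℕ} (θ : Matrix (Fin n) (Fin n) ℝ)
    (r s l p t q : Fin n → ℤ) :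
    phaseTheta θ (r, s) (p, t) * phaseTheta θ (s, l) (t, q) = phaseTheta θ (r, l) (p, q) := by
  simp only [phaseTheta]
  linear_combination phase θ r p * phase (-θ) l q * phase_mul_phase_neg θ s t

/-- For tensors whose middle degrees match, the phases of the two legs recombine into the phase of
the outer degrees. -/
theorem map₂_defMul_phaseTheta {n : ℕ} (θ : Matrix (Fin n) (Fin n) ℝ)
    {H A : Type} [Ring H] [Algebra ℂ H] [Ring A] [Algebra ℂ A]
    (ℋ : (Fin n → ℤ) × (Fin n → ℤ) → Submodule ℂ H) [GradedAlgebra ℋ]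
    (𝒜 : (Fin n → ℤ) × (Fin n → ℤ) → Submodule ℂ A) [GradedAlgebra 𝒜]
    {r l p q : Fin n → ℤ} {x y : A ⊗[ℂ] H}
    (hx : x ∈ ⨆ s : Fin n → ℤ,
      LinearMap.range (TensorProduct.map (𝒜 (r, s)).subtype (ℋ (s, l)).subtype))
    (hy : y ∈ ⨆ s : Fin n → ℤ,
      LinearMap.range (TensorProduct.map (𝒜 (p, s)).subtype (ℋ (s, q)).subtype)) :
    TensorProduct.map₂ (defMul 𝒜 (phaseTheta θ)) (defMul ℋ (phaseTheta θ)) x y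
      = phaseTheta θ (r, l) (p, q) • (x * y) := by
  induction hx using Submodule.iSup_induction' with
  | zero => simp
  | add x₁ x₂ _ _ h₁ h₂ => simp only [map_add, LinearMap.add_apply, h₁, h₂, add_mul, smul_add]
  | mem s x hx =>
    induction hy using Submodule.iSup_induction' with
    | zero => simp
    | add y₁ y₂ _ _ h₁ h₂ => simp only [map_add, h₁, h₂, mul_add, smul_add]
    | mem t y hy =>
      obtain ⟨u, rfl⟩ := hx
      obtain ⟨v, rfl⟩ := hy
      induction u using TensorProduct.induction_on with
      | zero => simp
      | add u₁ u₂ h₁ h₂ => simp only [map_add, LinearMap.add_apply, h₁, h₂, add_mul, smul_add]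
      | tmul a h =>
        induction v using TensorProduct.induction_on with
        | zero => simp
        | add v₁ v₂ h₁ h₂ => simp only [map_add, h₁, h₂, mul_add, smul_add]
        | tmul b k =>
          simp only [TensorProduct.map_tmul, Submodule.subtype_apply, TensorProduct.map₂_apply_tmul,
            Algebra.TensorProduct.tmul_mul_tmul, defMul_of_mem 𝒜 _ a.2 b.2,
            defMul_of_mem ℋ _ h.2 k.2, TensorProduct.smul_tmul_smul, phaseTheta_mul_phaseTheta]

theorem defMul_phaseTheta_one_one {n : ℕ} (θ : Matrix (Fin n) (Fin n) ℝ)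
    {H : Type} [Ring H] [Algebra ℂ H]
    (ℋ : (Fin n → ℤ) × (Fin n → ℤ) → Submodule ℂ H) [GradedAlgebra ℋ] :
    defMul ℋ (phaseTheta θ) 1 1 = 1 := by
  rw [defMul_of_mem ℋ _ (SetLike.one_mem_graded ℋ) (SetLike.one_mem_graded ℋ)]
  simp [phaseTheta, phase]

theorem deformed_comodule_algebra_II {n : ℕ} (θ : Matrix (Fin n) (Fin n) ℝ)
    (hθ : ∀ j k, θ k j = - θ j k)
    {H A : Type} [Ring H] [HopfAlgebra ℂ H] [Ring A] [Algebra ℂ A]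
    (ℋ : (Fin n → ℤ) × (Fin n → ℤ) → Submodule ℂ H) [GradedAlgebra ℋ]
    (𝒜 : (Fin n → ℤ) × (Fin n → ℤ) → Submodule ℂ A) [GradedAlgebra 𝒜]
    -- (ii) the coproduct of `H` is compatible with the bigrading
    (hΔ : ∀ (r l : Fin n → ℤ), ∀ h ∈ ℋ (r, l),
      Coalgebra.comul (R := ℂ) h ∈
        ⨆ s : Fin n → ℤ,
          LinearMap.range (TensorProduct.map (ℋ (r, s)).subtype (ℋ (s, l)).subtype))
    -- (iii) the counit vanishes off the "diagonal" part of the bigrading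
    (hε : ∀ (r l : Fin n → ℤ), r ≠ l → ∀ h ∈ ℋ (r, l),
      Coalgebra.counit (R := ℂ) h = (0 : ℂ))
    -- (iv) the antipode maps `H_{(r,l)}` into `H_{(-l,-r)}`
    (hS : ∀ (r l : Fin n → ℤ), ∀ h ∈ ℋ (r, l),
      HopfAlgebra.antipode (R := ℂ) h ∈ ℋ (-l, -r))
    -- the coaction of `H` on `A`, a comodule algebra structure
    (δ : A →ₐ[ℂ] A ⊗[ℂ] H)
    (hcoassoc : ∀ a : A,
      (TensorProduct.map LinearMap.id (Coalgebra.comul (R := ℂ) (A := H))) (δ a)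
        = (TensorProduct.assoc ℂ A H H) ((TensorProduct.map δ.toLinearMap LinearMap.id) (δ a)))
    (hcounit : ∀ a : A,
      (TensorProduct.rid ℂ A)
        ((TensorProduct.map LinearMap.id (Coalgebra.counit (R := ℂ) (A := H))) (δ a)) = a)
    -- the coaction is compatible with the bigradings:
    -- `δ(A_{(r,l)}) ⊆ ⊕_s A_{(r,s)} ⊗ H_{(s,l)}`
    (hδgrad : ∀ (r l : Fin n → ℤ), ∀ a ∈ 𝒜 (r, l),
      δ a ∈ ⨆ s : Fin n → ℤ,
        LinearMap.range (TensorProduct.map (𝒜 (r, s)).subtype (ℋ (s, l)).subtype)) :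
    -- the same coaction is an algebra map for the deformed products
    (∀ a a' : A,
      δ (defMul 𝒜 (phaseTheta θ) a a')
        = TensorProduct.map₂ (defMul 𝒜 (phaseTheta θ)) (defMul ℋ (phaseTheta θ))
            (δ a) (δ a')) ∧
    -- the coinvariant subspace is unchanged and closed under the deformed product
    (∀ a a' : A, δ a = a ⊗ₜ[ℂ] (1 : H) → δ a' = a' ⊗ₜ[ℂ] (1 : H) →
      δ (defMul 𝒜 (phaseTheta θ) a a')
        = (defMul 𝒜 (phaseTheta θ) a a') ⊗ₜ[ℂ] (1 : H)) := by
  have hmul : ∀ a a' : A,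
      δ (defMul 𝒜 (phaseTheta θ) a a')
        = TensorProduct.map₂ (defMul 𝒜 (phaseTheta θ)) (defMul ℋ (phaseTheta θ))
            (δ a) (δ a') := by
    intro a a'
    induction a using DirectSum.Decomposition.inductionOn 𝒜 with
    | zero => simp
    | add a₁ a₂ h₁ h₂ => simp only [map_add, LinearMap.add_apply, h₁, h₂]
    | @homogeneous i a =>
      induction a' using DirectSum.Decomposition.inductionOn 𝒜 with
      | zero => simp
      | add a₁ a₂ h₁ h₂ => simp only [map_add, h₁, h₂]
      | @homogeneous j a' =>
        obtain ⟨r, l⟩ := i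
        obtain ⟨p, q⟩ := j
        rw [defMul_of_mem 𝒜 _ a.2 a'.2,
          map₂_defMul_phaseTheta θ ℋ 𝒜 (hδgrad r l a a.2) (hδgrad p q a' a'.2), map_smul, map_mul]
  refine ⟨hmul, fun a a' ha ha' => ?_⟩
  rw [hmul, ha, ha', TensorProduct.map₂_apply_tmul, TensorProduct.map_tmul,
    defMul_phaseTheta_one_one]

end
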